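/- arXiv:1408.1835 — 5 statements merged into one kernel-verified Lean document; each statement's English description precedes it below -/
import Mathlib

section
/- For every a ∈ (−1,1) ∖ {0}, every n ≥ 1 and every m with 1 ≤ m ≤ 2^n, the number a_{n,m} satisfies 0 < |a_{n,m}| < b_n; in particular a_{n,m}/b_n ∈ (−1,1) ∖ {0}. -/
/-- Given `a ∈ (−1,1) ∖ {0}`, `b 0 = 1`, `b n = 2^(2^(n+1)−2)` for `n ≥ 1`
(so that `b n = 4 * (b (n-1))^2`), `A 0 1 = a`, and recursively
`A n m = (−1)^m * (A (n−1) ⌈m/2⌉ + (−1)^m * b (n−1))^2` for `n ≥ 1`, `1 ≤ m ≤ 2^n`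
(here `⌈m/2⌉ = (m+1)/2` with natural division), then for every `n ≥ 1` and `1 ≤ m ≤ 2^n`
one has `0 < |A n m| < b n`; in particular `A n m / b n ∈ (−1,1) ∖ {0}`. -/
theorem stmt_0 (a : ℝ) (ha : a ∈ Set.Ioo (-1 : ℝ) 1) (ha0 : a ≠ 0)
    (b : ℕ → ℝ) (hb0 : b 0 = 1)
    (hb : ∀ n : ℕ, 1 ≤ n → b n = 2 ^ (2 ^ (n + 1) - 2))
    (A : ℕ → ℕ → ℝ) (hA0 : A 0 1 = a)
    (hA : ∀ n : ℕ, 1 ≤ n → ∀ m : ℕ, 1 ≤ m → m ≤ 2 ^ n →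
      A n m = (-1 : ℝ) ^ m * (A (n - 1) ((m + 1) / 2) + (-1 : ℝ) ^ m * b (n - 1)) ^ 2)
    (n : ℕ) (hn : 1 ≤ n) (m : ℕ) (hm1 : 1 ≤ m) (hm2 : m ≤ 2 ^ n) :
    0 < |A n m| ∧ |A n m| < b n ∧
      A n m / b n ∈ Set.Ioo (-1 : ℝ) 1 ∧ A n m / b n ≠ 0 := by
  have hb' : ∀ k : ℕ, b k = 2 ^ (2 ^ (k + 1) - 2) := by
    intro k
    rcases Nat.eq_zero_or_pos k with h | h
    · subst h; simp [hb0]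
    · exact hb k h
  have hbs : ∀ k : ℕ, b (k + 1) = 4 * b k ^ 2 := by
    intro k
    rw [hb', hb']
    have h1 : 2 ^ (k + 1 + 1) - 2 = 2 + (2 ^ (k + 1) - 2) * 2 := by
      have h2 : 1 ≤ 2 ^ k := Nat.one_le_two_pow
      have h3 : 2 ^ (k + 1) = 2 * 2 ^ k := by ring
      have h4 : 2 ^ (k + 1 + 1) = 4 * 2 ^ k := by ring
      omega
    rw [h1, pow_add, pow_mul]
    norm_num
  have hbpos : ∀ k : ℕ, 0 < b k := by
    intro k
    rw [hb']
    positivity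
  have key : ∀ k m : ℕ, 1 ≤ m → m ≤ 2 ^ k → A k m ≠ 0 ∧ |A k m| < b k := by
    intro k
    induction k with
    | zero =>
      intro m h1 h2
      have : m = 1 := by simp at h2; omega
      subst this
      rw [hA0, hb0]
      exact ⟨ha0, abs_lt.mpr ha⟩
    | succ k ih =>
      intro m h1 h2
      have h3 : 2 ^ (k + 1) = 2 * 2 ^ k := by ring
      obtain ⟨_, i2⟩ := ih ((m + 1) / 2) (by omega) (by omega)
      have e := hA (k + 1) (by omega) m h1 h2
      rw [Nat.add_sub_cancel] at e
      have hp := hbpos k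
      rw [e, hbs]
      rw [abs_lt] at i2
      obtain ⟨l, u⟩ := i2
      generalize A k ((m + 1) / 2) = x at *
      refine ⟨mul_ne_zero (by simp) (pow_ne_zero _ ?_), ?_⟩
      · rcases neg_one_pow_eq_or ℝ m with h | h <;> rw [h] <;> intro h0 <;> linarith
      · rw [abs_mul, abs_pow, abs_neg, abs_one, one_pow, one_mul, abs_of_nonneg (sq_nonneg _)]
        rcases neg_one_pow_eq_or ℝ m with h | h <;> rw [h] <;> nlinarith
  obtain ⟨k1, k2⟩ := key n m hm1 hm2
  have hp := hbpos n
  refine ⟨abs_pos.mpr k1, k2, ?_, div_ne_zero k1 hp.ne'⟩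
  rw [abs_lt] at k2
  constructor
  · rw [lt_div_iff₀ hp]; linarith
  · rw [div_lt_iff₀ hp]; linarith
end

section
/- For every a ∈ (−1,1) ∖ {0} and every n ≥ 0, the n-th preimage of a under f is exactly the set {a_{n,m}/b_n : 1 ≤ m ≤ 2^n}; that is, f^{−n}({a}) = {a_{n,m}/b_n : m = 1, …, 2^n} as subsets of [−1,1] ∖ {0}. -/
/-- Let `f` be given on `[−1,1] ∖ {0}` by `f x = 2√x − 1` for `x > 0` and
`f x = −2√|x| + 1` for `x < 0`.  With `a ∈ (−1,1) ∖ {0}`, `b 0 = 1`,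
`b n = 2^(2^(n+1)−2)` for `n ≥ 1`, `A 0 1 = a` and
`A n m = (−1)^m * (A (n−1) ⌈m/2⌉ + (−1)^m * b (n−1))^2` for `n ≥ 1`, `1 ≤ m ≤ 2^n`,
for every `n ≥ 0` the `n`-th preimage of `a` under `f` (points `x ∈ [−1,1] ∖ {0}`
all of whose intermediate iterates stay in `[−1,1] ∖ {0}` and whose `n`-th iterate is `a`)
is exactly `{A n m / b n : 1 ≤ m ≤ 2^n}`. -/
theorem stmt_1 (f : ℝ → ℝ)
    (hfpos : ∀ x : ℝ, 0 < x → f x = 2 * Real.sqrt x - 1)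
    (hfneg : ∀ x : ℝ, x < 0 → f x = -2 * Real.sqrt |x| + 1)
    (a : ℝ) (ha : a ∈ Set.Ioo (-1 : ℝ) 1) (ha0 : a ≠ 0)
    (b : ℕ → ℝ) (hb0 : b 0 = 1)
    (hb : ∀ n : ℕ, 1 ≤ n → b n = 2 ^ (2 ^ (n + 1) - 2))
    (A : ℕ → ℕ → ℝ) (hA0 : A 0 1 = a)
    (hA : ∀ n : ℕ, 1 ≤ n → ∀ m : ℕ, 1 ≤ m → m ≤ 2 ^ n →
      A n m = (-1 : ℝ) ^ m * (A (n - 1) ((m + 1) / 2) + (-1 : ℝ) ^ m * b (n - 1)) ^ 2)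
    (n : ℕ) :
    {x : ℝ | x ∈ Set.Icc (-1 : ℝ) 1 \ {0} ∧
        (∀ i : ℕ, i < n → f^[i] x ∈ Set.Icc (-1 : ℝ) 1 \ {0}) ∧ f^[n] x = a}
      = {x : ℝ | ∃ m : ℕ, 1 ≤ m ∧ m ≤ 2 ^ n ∧ x = A n m / b n} := by
  have hbpos : ∀ n, 0 < b n := by
    intro n
    rcases Nat.eq_zero_or_pos n with h | h
    · subst h; rw [hb0]; norm_num
    · rw [hb n h]; positivity
  have hbs : ∀ n, b (n + 1) = 4 * b n ^ 2 := by
    intro n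
    rcases Nat.eq_zero_or_pos n with h | h
    · subst h; rw [hb 1 le_rfl, hb0]; norm_num
    · rw [hb n h, hb (n + 1) (by omega), ← pow_mul]
      have h1 : 2 ^ 1 ≤ 2 ^ (n + 1) := Nat.pow_le_pow_right (by norm_num) (by omega)
      have h2 : 2 ^ (n + 1 + 1) - 2 = 2 + (2 ^ (n + 1) - 2) * 2 := by
        rw [pow_succ 2 (n + 1)]; omega
      rw [h2, pow_add]; norm_num
  have heven : ∀ n k, 1 ≤ k → k ≤ 2 ^ n →
      A (n + 1) (2 * k) / b (n + 1) = ((A n k / b n + 1) / 2) ^ 2 := by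
    intro n k h1 h2
    have hp := (hbpos n).ne'
    rw [hA (n + 1) (by omega) (2 * k) (by omega) (by rw [pow_succ]; omega), hbs,
      show (2 * k + 1) / 2 = k by omega, Even.neg_one_pow (even_two_mul k)]
    simp only [Nat.add_sub_cancel]
    field_simp
    ring
  have hodd : ∀ n k, 1 ≤ k → k ≤ 2 ^ n →
      A (n + 1) (2 * k - 1) / b (n + 1) = -((1 - A n k / b n) / 2) ^ 2 := by
    intro n k h1 h2
    have hp := (hbpos n).ne'
    have ho : Odd (2 * k - 1) := ⟨k - 1, by omega⟩
    rw [hA (n + 1) (by omega) (2 * k - 1) (by omega) (by rw [pow_succ]; omega), hbs,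
      show (2 * k - 1 + 1) / 2 = k by omega, Odd.neg_one_pow ho]
    simp only [Nat.add_sub_cancel]
    field_simp
    ring
  have hp1 : ∀ y : ℝ, -1 < y → y < 1 → (0 < ((y + 1) / 2) ^ 2 ∧ ((y + 1) / 2) ^ 2 < 1 ∧
      f (((y + 1) / 2) ^ 2) = y) := by
    intro y h1 h2
    have h3 : 0 < ((y + 1) / 2) ^ 2 := by
      have : 0 < (y + 1) / 2 := by linarith
      positivity
    refine ⟨h3, by nlinarith, ?_⟩
    rw [hfpos _ h3, Real.sqrt_sq (by linarith)]; ring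
  have hp2 : ∀ y : ℝ, -1 < y → y < 1 → (-((1 - y) / 2) ^ 2 < 0 ∧ -1 < -((1 - y) / 2) ^ 2 ∧
      f (-((1 - y) / 2) ^ 2) = y) := by
    intro y h1 h2
    have h3 : 0 < ((1 - y) / 2) ^ 2 := by
      have : 0 < (1 - y) / 2 := by linarith
      positivity
    refine ⟨by linarith, by nlinarith, ?_⟩
    rw [hfneg _ (by linarith), abs_neg, abs_of_pos h3, Real.sqrt_sq (by linarith)]; ring
  have hinv : ∀ x : ℝ, x ≠ 0 → x = ((f x + 1) / 2) ^ 2 ∨ x = -((1 - f x) / 2) ^ 2 := by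
    intro x hx
    rcases lt_or_gt_of_ne hx with h | h
    · right
      rw [hfneg x h]
      have := Real.sq_sqrt (abs_nonneg x)
      rw [abs_of_neg h] at *
      linear_combination this
    · left
      rw [hfpos x h]
      have := Real.sq_sqrt h.le
      linear_combination -this
  have hcase : ∀ m : ℕ, 1 ≤ m → ∀ n, m ≤ 2 ^ (n + 1) → ∃ k, 1 ≤ k ∧ k ≤ 2 ^ n ∧
      (m = 2 * k ∨ m = 2 * k - 1) := by
    intro m h n h2
    rw [pow_succ] at h2
    exact ⟨(m + 1) / 2, by omega, by omega, by omega⟩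
  have hr : ∀ n m, 1 ≤ m → m ≤ 2 ^ n →
      -1 < A n m / b n ∧ A n m / b n < 1 ∧ A n m / b n ≠ 0 := by
    intro n
    induction n with
    | zero =>
      intro m h1 h2
      have : m = 1 := by simp at h2; omega
      subst this
      rw [hA0, hb0, div_one]
      exact ⟨ha.1, ha.2, ha0⟩
    | succ n ih =>
      intro m h1 h2
      obtain ⟨k, hk1, hk2, rfl | rfl⟩ := hcase m h1 n h2
      · obtain ⟨u, v, _⟩ := ih k hk1 hk2
        rw [heven n k hk1 hk2]
        obtain ⟨p, q, _⟩ := hp1 _ u v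
        exact ⟨by linarith, q, p.ne'⟩
      · obtain ⟨u, v, _⟩ := ih k hk1 hk2
        rw [hodd n k hk1 hk2]
        obtain ⟨p, q, _⟩ := hp2 _ u v
        exact ⟨q, by linarith, p.ne⟩
  have key : ∀ n, ∀ x : ℝ, (x ∈ Set.Icc (-1 : ℝ) 1 \ {0} ∧
        (∀ i : ℕ, i < n → f^[i] x ∈ Set.Icc (-1 : ℝ) 1 \ {0}) ∧ f^[n] x = a) ↔
        ∃ m : ℕ, 1 ≤ m ∧ m ≤ 2 ^ n ∧ x = A n m / b n := by
    intro n
    induction n with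
    | zero =>
      intro x
      constructor
      · rintro ⟨_, _, h⟩
        exact ⟨1, le_rfl, by simp, by rw [hA0, hb0, div_one]; exact h⟩
      · rintro ⟨m, h1, h2, h⟩
        have : m = 1 := by simp at h2; omega
        subst this
        rw [hA0, hb0, div_one] at h
        subst h
        exact ⟨⟨⟨ha.1.le, ha.2.le⟩, ha0⟩, by simp, rfl⟩
    | succ n ih =>
      intro x
      constructor
      · rintro ⟨hx, hi, h⟩
        have hfx : f x ∈ Set.Icc (-1 : ℝ) 1 \ {0} := by
          rcases Nat.eq_zero_or_pos n with h0 | h0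
          · subst h0
            have h' : f x = a := h
            rw [h']
            exact ⟨⟨ha.1.le, ha.2.le⟩, ha0⟩
          · exact hi 1 (by omega)
        obtain ⟨k, hk1, hk2, hk⟩ := (ih (f x)).1
          ⟨hfx, fun i h => hi (i + 1) (by omega), h⟩
        rcases hinv x hx.2 with h | h
        · exact ⟨2 * k, by omega, by rw [pow_succ]; omega, by rw [heven n k hk1 hk2, ← hk]; exact h⟩
        · exact ⟨2 * k - 1, by omega, by rw [pow_succ]; omega,
            by rw [hodd n k hk1 hk2, ← hk]; exact h⟩
      · rintro ⟨m, h1, h2, h⟩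
        obtain ⟨u, v, w⟩ := hr (n + 1) m h1 h2
        rw [← h] at u v w
        have hx : x ∈ Set.Icc (-1 : ℝ) 1 \ {0} := ⟨⟨u.le, v.le⟩, w⟩
        have hf : ∃ k, 1 ≤ k ∧ k ≤ 2 ^ n ∧ f x = A n k / b n := by
          obtain ⟨k, hk1, hk2, rfl | rfl⟩ := hcase m h1 n h2
          · obtain ⟨u, v, _⟩ := hr n k hk1 hk2
            rw [heven n k hk1 hk2] at h
            exact ⟨k, hk1, hk2, by rw [h]; exact (hp1 _ u v).2.2⟩
          · obtain ⟨u, v, _⟩ := hr n k hk1 hk2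
            rw [hodd n k hk1 hk2] at h
            exact ⟨k, hk1, hk2, by rw [h]; exact (hp2 _ u v).2.2⟩
        obtain ⟨_, q, r⟩ := (ih (f x)).2 hf
        refine ⟨hx, ?_, r⟩
        intro i hi
        cases i with
        | zero => exact hx
        | succ i => exact q i (by omega)
  ext x
  exact key n x
end

section
/- For every integer k ≥ 2, every a ∈ [−1,1] and every n ≥ 0, the one-dimensional Lebesgue measure of the slice C_n(a) satisfies Leb(C_n(a)) ≤ 2·4^{−n/k}. -/
open MeasureTheory ENNReal

open scoped Pointwise in
theorem aux_affine (c d : ℝ) (s : Set ℝ) :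
    volume ((fun y : ℝ => c * y + d) '' s) = ENNReal.ofReal |c| * volume s := by
  have h : (fun y : ℝ => c * y + d) '' s = (fun y : ℝ => y + d) '' (c • s) := by
    rw [← Set.image_smul, Set.image_image]
    rfl
  rw [h, Set.image_add_right, measure_preimage_add_right, Measure.addHaar_smul]
  simp

theorem aux_conc (p : ℝ) (hp0 : 0 ≤ p) (hp : p ≤ 1) (u v : ℝ) (hu : 0 ≤ u) (hv : 0 ≤ v)
    (h : u + v = 1) : u ^ p / 2 + v ^ p / 2 ≤ (1 / 2 : ℝ) ^ p := by
  have := (Real.concaveOn_rpow hp0 hp).2 (Set.mem_Ici.2 hu) (Set.mem_Ici.2 hv)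
    (by norm_num : (0 : ℝ) ≤ 1 / 2) (by norm_num : (0 : ℝ) ≤ 1 / 2) (by norm_num)
  simp only [smul_eq_mul] at this
  have e : 1 / 2 * u + 1 / 2 * v = 1 / 2 := by linarith
  rw [e] at this
  linarith

/-- In the setting of the iterated Poincaré-type map `F_k`
(`S 0 = Σ ∖ Γ`, `S (n+1) = F_k (S n ∖ Γ)`, `C n a = {y ∈ [−1,1] : (a,y) ∈ S n}`),
for every `k ≥ 2`, every `a ∈ [−1,1]` and every `n ≥ 0`,
`Leb (C n a) ≤ 2 · 4^(−n/k)`. -/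
theorem stmt_5 (k : ℕ) (hk : 2 ≤ k)
    (F : ℝ × ℝ → ℝ × ℝ)
    (hFpos : ∀ x y : ℝ, 0 < x →
      F (x, y) = (2 * Real.sqrt x - 1, (y * x ^ ((1 : ℝ) / k) + 1) / 2))
    (hFneg : ∀ x y : ℝ, x < 0 →
      F (x, y) = (-2 * Real.sqrt |x| + 1, (y * |x| ^ ((1 : ℝ) / k) - 1) / 2))
    (S : ℕ → Set (ℝ × ℝ))
    (hS0 : S 0 = (Set.Icc (-1 : ℝ) 1 ×ˢ Set.Icc (-1 : ℝ) 1) \ {p : ℝ × ℝ | p.1 = 0})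
    (hSsucc : ∀ n : ℕ, S (n + 1) = F '' (S n \ {p : ℝ × ℝ | p.1 = 0}))
    (a : ℝ) (ha : a ∈ Set.Icc (-1 : ℝ) 1) (n : ℕ) :
    volume {y : ℝ | y ∈ Set.Icc (-1 : ℝ) 1 ∧ (a, y) ∈ S n} ≤
      2 * (4 : ℝ≥0∞) ^ (-(n : ℝ) / k) := by
  have hk0 : (0 : ℝ) < k := by
    have : 0 < k := by omega
    exact_mod_cast this
  have hk2 : (2 : ℝ) ≤ k := by exact_mod_cast hk
  have key : ∀ n : ℕ, ∀ a ∈ Set.Icc (-1 : ℝ) 1,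
      volume {y : ℝ | (a, y) ∈ S n} ≤ ENNReal.ofReal (2 * (4 : ℝ) ^ (-(n : ℝ) / k)) := by
    intro n
    induction n with
    | zero =>
      intro a ha
      refine (measure_mono (t := Set.Icc (-1 : ℝ) 1) ?_).trans ?_
      · intro y hy
        simp only [Set.mem_ofPred_eq, hS0] at hy
        exact hy.1.2
      · rw [Real.volume_Icc]
        apply ENNReal.ofReal_le_ofReal
        norm_num
    | succ n ih =>
      intro a ha
      obtain ⟨ha1, ha2⟩ := ha
      set u : ℝ := (1 + a) / 2 with hu
      set v : ℝ := (1 - a) / 2 with hv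
      have hu0 : 0 ≤ u := by linarith
      have hv0 : 0 ≤ v := by linarith
      have huv : u + v = 1 := by rw [hu, hv]; ring
      have hsub : {y : ℝ | (a, y) ∈ S (n + 1)} ⊆
          ((fun y : ℝ => (u ^ 2) ^ ((1 : ℝ) / k) / 2 * y + 1 / 2) '' {y : ℝ | (u ^ 2, y) ∈ S n}) ∪
          ((fun y : ℝ => (v ^ 2) ^ ((1 : ℝ) / k) / 2 * y + (-1 / 2)) ''
            {y : ℝ | (-v ^ 2, y) ∈ S n}) := by
        intro y hy
        simp only [Set.mem_ofPred_eq, hSsucc] at hy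
        obtain ⟨⟨x, z⟩, ⟨hS, hx⟩, hF⟩ := hy
        simp only [Set.mem_ofPred_eq] at hx
        rcases lt_or_gt_of_ne hx with h | h
        · right
          rw [hFneg x z h, Prod.mk.injEq] at hF
          have hs : √|x| = v := by rw [hv]; linarith [hF.1]
          have hx2 : |x| = v ^ 2 := by rw [← hs, Real.sq_sqrt (abs_nonneg x)]
          have hx3 : x = -v ^ 2 := by rw [← hx2, abs_of_neg h]; ring
          refine ⟨z, ?_, ?_⟩
          · rw [Set.mem_ofPred_eq, ← hx3]; exact hS
          · rw [← hF.2, hx2]; ring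
        · left
          rw [hFpos x z h, Prod.mk.injEq] at hF
          have hs : √x = u := by rw [hu]; linarith [hF.1]
          have hx2 : x = u ^ 2 := by rw [← hs, Real.sq_sqrt h.le]
          refine ⟨z, ?_, ?_⟩
          · rw [Set.mem_ofPred_eq, ← hx2]; exact hS
          · rw [← hF.2, hx2]; ring
      have hu1 : u ≤ 1 := by linarith
      have hv1 : v ≤ 1 := by linarith
      have i1 := ih (u ^ 2) ⟨by nlinarith, by nlinarith⟩
      have i2 := ih (-v ^ 2) ⟨by nlinarith, by nlinarith⟩
      refine (measure_mono hsub).trans ((measure_union_le _ _).trans ?_)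
      rw [aux_affine, aux_affine]
      refine (add_le_add (mul_le_mul_right i1 _) (mul_le_mul_right i2 _)).trans ?_
      rw [← add_mul, ← ENNReal.ofReal_add (abs_nonneg _) (abs_nonneg _),
        ← ENNReal.ofReal_mul (by positivity)]
      apply ENNReal.ofReal_le_ofReal
      have e : ∀ w : ℝ, 0 ≤ w → (w ^ 2) ^ ((1 : ℝ) / k) = w ^ ((2 : ℝ) / k) := by
        intro w hw
        rw [← Real.rpow_natCast, ← Real.rpow_mul hw]
        congr 1
        push_cast
        ring
      have hc := aux_conc ((2 : ℝ) / k) (by positivity) (by rw [div_le_one hk0]; exact hk2)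
        u v hu0 hv0 huv
      rw [abs_of_nonneg (by positivity), abs_of_nonneg (by positivity), e u hu0, e v hv0]
      have h4 : (1 / 2 : ℝ) ^ ((2 : ℝ) / k) = 4 ^ (-1 / (k : ℝ)) := by
        rw [← e _ (by norm_num)]
        rw [show ((1 / 2 : ℝ) ^ 2) = 4⁻¹ by norm_num, Real.inv_rpow (by norm_num),
          ← Real.rpow_neg (by norm_num)]
        congr 1
        ring
      have h5 : (4 : ℝ) ^ (-((n + 1 : ℕ) : ℝ) / k) = 4 ^ (-1 / (k : ℝ)) * 4 ^ (-(n : ℝ) / k) := by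
        rw [← Real.rpow_add (by norm_num)]
        congr 1
        push_cast
        ring
      rw [h5, ← h4]
      calc _ ≤ (1 / 2 : ℝ) ^ ((2 : ℝ) / k) * (2 * 4 ^ (-(n : ℝ) / k)) :=
            mul_le_mul_of_nonneg_right hc (by positivity)
        _ = _ := by ring
  refine (measure_mono (fun y hy => hy.2)).trans ((key n a ha).trans (le_of_eq ?_))
  rw [ENNReal.ofReal_mul (by norm_num), ← ENNReal.ofReal_rpow_of_pos (by norm_num)]
  norm_num
end

section
/- For every integer k ≥ 2 and every a ∈ [−1,1], the vertical slice C(a) = {y ∈ [−1,1] : (a,y) ∈ ⋂_{n≥0} S_n} of the sectional attractor of F_k has one-dimensional Lebesgue measure zero. -/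
open MeasureTheory ENNReal

theorem aux_image (c b : ℝ) (hc : 0 ≤ c) (s : Set ℝ) :
    volume ((fun y : ℝ => (y * c + b) / 2) '' s) = ENNReal.ofReal (c / 2) * volume s := by
  have h : (fun y : ℝ => (y * c + b) / 2) '' s
      = (fun z => b / 2 + z) '' ((fun y => (c / 2) • y) '' s) := by
    rw [Set.image_image]
    apply Set.image_congr
    intro y _
    simp only [smul_eq_mul]
    ring
  rw [h, Set.image_add_left, measure_preimage_add, Set.image_smul, Measure.addHaar_smul]
  simp [abs_of_nonneg (show 0 ≤ c / 2 by positivity)]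

theorem aux_ineq (k : ℕ) (hk : 2 ≤ k) (a : ℝ) (ha : a ∈ Set.Icc (-1 : ℝ) 1) :
    (((1 + a) / 2) ^ 2) ^ ((1 : ℝ) / k) / 2 + (((1 - a) / 2) ^ 2) ^ ((1 : ℝ) / k) / 2
      ≤ (1 / 2 : ℝ) ^ ((2 : ℝ) / k) := by
  obtain ⟨h1, h2⟩ := ha
  have hk' : (2 : ℝ) ≤ k := by exact_mod_cast hk
  have e : ∀ u : ℝ, 0 ≤ u → (u ^ 2) ^ ((1 : ℝ) / k) = u ^ ((2 : ℝ) / k) := by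
    intro u hu
    rw [← Real.rpow_natCast, ← Real.rpow_mul hu]
    congr 1
    push_cast
    ring
  rw [e _ (by linarith), e _ (by linarith)]
  have hs : (2 : ℝ) / k ≤ 1 := by
    rw [div_le_one (by linarith)]; exact hk'
  have hcv : ConcaveOn ℝ (Set.Ici 0) (fun x : ℝ => x ^ ((2 : ℝ) / k)) :=
    Real.concaveOn_rpow (by positivity) hs
  have m1 : (1 + a) / 2 ∈ Set.Ici (0 : ℝ) := Set.mem_Ici.2 (by linarith)
  have m2 : (1 - a) / 2 ∈ Set.Ici (0 : ℝ) := Set.mem_Ici.2 (by linarith)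
  have hc := hcv.2 m1 m2 (show (0 : ℝ) ≤ 1 / 2 by norm_num) (show (0 : ℝ) ≤ 1 / 2 by norm_num)
    (by norm_num)
  simp only [smul_eq_mul] at hc
  have e2 : 1 / 2 * ((1 + a) / 2) + 1 / 2 * ((1 - a) / 2) = (1 / 2 : ℝ) := by ring
  rw [e2] at hc
  linarith

/-- In the setting of the iterated Poincaré-type map `F_k`
(`S 0 = Σ ∖ Γ`, `S (n+1) = F_k (S n ∖ Γ)`), for every `k ≥ 2` and every `a ∈ [−1,1]`,
the vertical slice `C a = {y ∈ [−1,1] : (a,y) ∈ ⋂ n, S n}` of the sectional attractor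
has one-dimensional Lebesgue measure zero. -/
theorem stmt_6 (k : ℕ) (hk : 2 ≤ k)
    (F : ℝ × ℝ → ℝ × ℝ)
    (hFpos : ∀ x y : ℝ, 0 < x →
      F (x, y) = (2 * Real.sqrt x - 1, (y * x ^ ((1 : ℝ) / k) + 1) / 2))
    (hFneg : ∀ x y : ℝ, x < 0 →
      F (x, y) = (-2 * Real.sqrt |x| + 1, (y * |x| ^ ((1 : ℝ) / k) - 1) / 2))
    (S : ℕ → Set (ℝ × ℝ))
    (hS0 : S 0 = (Set.Icc (-1 : ℝ) 1 ×ˢ Set.Icc (-1 : ℝ) 1) \ {p : ℝ × ℝ | p.1 = 0})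
    (hSsucc : ∀ n : ℕ, S (n + 1) = F '' (S n \ {p : ℝ × ℝ | p.1 = 0}))
    (a : ℝ) (ha : a ∈ Set.Icc (-1 : ℝ) 1) :
    volume {y : ℝ | y ∈ Set.Icc (-1 : ℝ) 1 ∧ (a, y) ∈ ⋂ n : ℕ, S n} = 0 := by
  set r : ℝ := (1 / 2 : ℝ) ^ ((2 : ℝ) / k) with hr
  have hk' : (2 : ℝ) ≤ k := by exact_mod_cast hk
  have hr0 : 0 ≤ r := by positivity
  have hr1 : r < 1 := Real.rpow_lt_one (by norm_num) (by norm_num) (by positivity)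
  have key : ∀ n : ℕ, ∀ a ∈ Set.Icc (-1 : ℝ) 1,
      volume {y : ℝ | (a, y) ∈ S n} ≤ ENNReal.ofReal r ^ n * 2 := by
    intro n
    induction n with
    | zero =>
      intro a _
      have hsub : {y : ℝ | (a, y) ∈ S 0} ⊆ Set.Icc (-1 : ℝ) 1 := by
        intro y hy
        simp only [Set.mem_ofPred_eq, hS0] at hy
        exact hy.1.2
      refine (measure_mono hsub).trans ?_
      rw [Real.volume_Icc]
      norm_num
    | succ n ih =>
      intro a ha
      have hab := ha
      obtain ⟨h1, h2⟩ := ha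
      set c : ℝ := (((1 + a) / 2) ^ 2) ^ ((1 : ℝ) / k) with hc
      set d : ℝ := (((1 - a) / 2) ^ 2) ^ ((1 : ℝ) / k) with hd
      have hc0 : 0 ≤ c := by positivity
      have hd0 : 0 ≤ d := by positivity
      have hsub : {y : ℝ | (a, y) ∈ S (n + 1)} ⊆
          (fun y : ℝ => (y * c + 1) / 2) '' {y | (((1 + a) / 2) ^ 2, y) ∈ S n} ∪
          (fun y : ℝ => (y * d + (-1)) / 2) '' {y | (-((1 - a) / 2) ^ 2, y) ∈ S n} := by
        intro y hy
        simp only [Set.mem_ofPred_eq, hSsucc] at hy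
        obtain ⟨⟨x, z⟩, ⟨hxS, hx0⟩, hF⟩ := hy
        simp only [Set.mem_ofPred_eq] at hx0
        rcases lt_or_gt_of_ne hx0 with hx | hx
        · right
          rw [hFneg x z hx, Prod.mk.injEq] at hF
          have hq : |x| = ((1 - a) / 2) ^ 2 := by
            rw [← Real.sq_sqrt (abs_nonneg x)]
            congr 1
            linarith [hF.1]
          have hxq : x = -((1 - a) / 2) ^ 2 := by
            rw [← hq, abs_of_neg hx]; ring
          refine ⟨z, ?_, ?_⟩
          · simp only [Set.mem_ofPred_eq]
            rw [← hxq]; exact hxS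
          · rw [← hF.2, hq]
            simp only [← hd]
            ring
        · left
          rw [hFpos x z hx, Prod.mk.injEq] at hF
          have hq : x = ((1 + a) / 2) ^ 2 := by
            rw [← Real.sq_sqrt hx.le]
            congr 1
            linarith [hF.1]
          refine ⟨z, ?_, ?_⟩
          · simp only [Set.mem_ofPred_eq]
            rw [← hq]; exact hxS
          · rw [← hF.2, hq]
      have i1 := ih (((1 + a) / 2) ^ 2) ⟨by nlinarith, by nlinarith⟩
      have i2 := ih (-((1 - a) / 2) ^ 2) ⟨by nlinarith, by nlinarith⟩
      calc volume {y : ℝ | (a, y) ∈ S (n + 1)} ≤ _ := measure_mono hsub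
        _ ≤ _ := measure_union_le _ _
        _ = ENNReal.ofReal (c / 2) * volume {y | (((1 + a) / 2) ^ 2, y) ∈ S n} +
            ENNReal.ofReal (d / 2) * volume {y | (-((1 - a) / 2) ^ 2, y) ∈ S n} := by
          rw [aux_image _ _ hc0, aux_image _ _ hd0]
        _ ≤ ENNReal.ofReal (c / 2) * (ENNReal.ofReal r ^ n * 2) +
            ENNReal.ofReal (d / 2) * (ENNReal.ofReal r ^ n * 2) := by gcongr
        _ = ENNReal.ofReal (c / 2 + d / 2) * (ENNReal.ofReal r ^ n * 2) := by
          rw [ENNReal.ofReal_add (by positivity) (by positivity), add_mul]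
        _ ≤ ENNReal.ofReal r * (ENNReal.ofReal r ^ n * 2) := by
          gcongr
          exact aux_ineq k hk a hab
        _ = ENNReal.ofReal r ^ (n + 1) * 2 := by ring
  have hle : ∀ n : ℕ, volume {y : ℝ | y ∈ Set.Icc (-1 : ℝ) 1 ∧ (a, y) ∈ ⋂ n : ℕ, S n}
      ≤ ENNReal.ofReal r ^ n * 2 := fun n =>
    (measure_mono (show _ ⊆ {y : ℝ | (a, y) ∈ S n} from
      fun _ hy => Set.mem_iInter.1 hy.2 n)).trans (key n a ha)
  have ht : Filter.Tendsto (fun n : ℕ => ENNReal.ofReal r ^ n * 2) Filter.atTop (nhds (0 * 2)) :=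
    ENNReal.Tendsto.mul_const
      (ENNReal.tendsto_pow_atTop_nhds_zero_of_lt_one (by simpa using hr1)) (Or.inr (by simp))
  rw [zero_mul] at ht
  exact le_antisymm (ge_of_tendsto' ht hle) zero_le
end

section
/- For every integer k ≥ 2, the sectional attractor ⋂_{n≥0} S_n of F_k has two-dimensional Lebesgue measure zero. -/
open MeasureTheory ENNReal

open scoped Pointwise in
lemma aux_vol (a b : ℝ) (ha : 0 ≤ a) (A : Set ℝ) :
    volume ((fun y : ℝ => (y * a + b) / 2) '' A) = ENNReal.ofReal (a / 2) * volume A := by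
  have h : (fun y : ℝ => (y * a + b) / 2) '' A = (fun z => z + b / 2) '' ((a / 2) • A) := by
    rw [← Set.image_smul, Set.image_image]
    apply Set.image_congr
    intro y _
    simp only [smul_eq_mul]
    ring
  rw [h, Set.image_add_right, measure_preimage_add_right, Measure.addHaar_smul]
  simp [abs_of_nonneg (by positivity : 0 ≤ a / 2)]

lemma aux_meas_pos (q : ℝ) (A : Set (ℝ × ℝ)) (hA : MeasurableSet A) (hA0 : ∀ p ∈ A, 0 < p.1) :
    MeasurableSet ((fun p : ℝ × ℝ => (2 * Real.sqrt p.1 - 1, (p.2 * p.1 ^ q + 1) / 2)) '' A) := by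
  apply hA.image_of_measurable_injOn
  · fun_prop
  · rintro ⟨x, y⟩ h ⟨x', y'⟩ h' he
    have h1 := hA0 _ h
    have h2 := hA0 _ h'
    simp only [Prod.mk.injEq] at he h1 h2 ⊢
    obtain ⟨e1, e2⟩ := he
    have : x = x' := (Real.sqrt_inj h1.le h2.le).1 (by linarith)
    subst this
    refine ⟨rfl, ?_⟩
    have := Real.rpow_pos_of_pos h1 q
    exact mul_right_cancel₀ this.ne' (by linarith)

lemma aux_meas_neg (q : ℝ) (A : Set (ℝ × ℝ)) (hA : MeasurableSet A) (hA0 : ∀ p ∈ A, p.1 < 0) :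
    MeasurableSet ((fun p : ℝ × ℝ =>
      (-2 * Real.sqrt |p.1| + 1, (p.2 * |p.1| ^ q - 1) / 2)) '' A) := by
  apply hA.image_of_measurable_injOn
  · have : Measurable (fun p : ℝ × ℝ => |p.1|) := continuous_abs.measurable.comp measurable_fst
    fun_prop
  · rintro ⟨x, y⟩ h ⟨x', y'⟩ h' he
    have h1 := hA0 _ h
    have h2 := hA0 _ h'
    simp only [Prod.mk.injEq] at he h1 h2 ⊢
    obtain ⟨e1, e2⟩ := he
    rw [abs_of_neg h1, abs_of_neg h2] at e1 e2
    have : -x = -x' := (Real.sqrt_inj (by linarith) (by linarith)).1 (by linarith)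
    have : x = x' := by linarith
    subst this
    refine ⟨rfl, ?_⟩
    have := Real.rpow_pos_of_pos (neg_pos.2 h1) q
    exact mul_right_cancel₀ this.ne' (by linarith)

/-- In the setting of the iterated Poincaré-type map `F_k`
(`S 0 = Σ ∖ Γ`, `S (n+1) = F_k (S n ∖ Γ)`), for every `k ≥ 2` the sectional attractor
`⋂ n, S n` has two-dimensional Lebesgue measure zero. -/
theorem stmt_7 (k : ℕ) (hk : 2 ≤ k)
    (F : ℝ × ℝ → ℝ × ℝ)
    (hFpos : ∀ x y : ℝ, 0 < x →
      F (x, y) = (2 * Real.sqrt x - 1, (y * x ^ ((1 : ℝ) / k) + 1) / 2))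
    (hFneg : ∀ x y : ℝ, x < 0 →
      F (x, y) = (-2 * Real.sqrt |x| + 1, (y * |x| ^ ((1 : ℝ) / k) - 1) / 2))
    (S : ℕ → Set (ℝ × ℝ))
    (hS0 : S 0 = (Set.Icc (-1 : ℝ) 1 ×ˢ Set.Icc (-1 : ℝ) 1) \ {p : ℝ × ℝ | p.1 = 0})
    (hSsucc : ∀ n : ℕ, S (n + 1) = F '' (S n \ {p : ℝ × ℝ | p.1 = 0}))
    : volume (⋂ n : ℕ, S n) = 0 := by
  have hk2 : (2 : ℝ) ≤ k := by exact_mod_cast hk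
  have hk0 : (0 : ℝ) < k := by linarith
  set q : ℝ := (1 : ℝ) / k with hq
  have hq0 : 0 < q := by positivity
  have hq1 : q ≤ 1 / 2 := by
    rw [hq]; exact one_div_le_one_div_of_le (by norm_num) hk2
  -- measurability
  have hmeas : ∀ n, MeasurableSet (S n) := by
    intro n
    induction n with
    | zero =>
      rw [hS0]
      exact (measurableSet_Icc.prod measurableSet_Icc).diff
        (measurable_fst (measurableSet_singleton (0 : ℝ)))
    | succ n ih =>
      have e : S n \ {p : ℝ × ℝ | p.1 = 0} = (S n ∩ {p | 0 < p.1}) ∪ (S n ∩ {p | p.1 < 0}) := by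
        ext p
        simp only [Set.mem_sdiff, Set.mem_ofPred_eq, Set.mem_union, Set.mem_inter_iff]
        constructor
        · rintro ⟨h1, h2⟩
          rcases lt_or_gt_of_ne h2 with h | h
          · exact Or.inr ⟨h1, h⟩
          · exact Or.inl ⟨h1, h⟩
        · rintro (⟨h1, h2⟩ | ⟨h1, h2⟩)
          · exact ⟨h1, h2.ne'⟩
          · exact ⟨h1, h2.ne⟩
      rw [hSsucc, e, Set.image_union]
      apply MeasurableSet.union
      · rw [Set.image_congr (g := fun p : ℝ × ℝ =>
          (2 * Real.sqrt p.1 - 1, (p.2 * p.1 ^ q + 1) / 2)) (fun p hp => hFpos p.1 p.2 hp.2)]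
        exact aux_meas_pos q _ (ih.inter (measurable_fst measurableSet_Ioi)) (fun p hp => hp.2)
      · rw [Set.image_congr (g := fun p : ℝ × ℝ =>
          (-2 * Real.sqrt |p.1| + 1, (p.2 * |p.1| ^ q - 1) / 2)) (fun p hp => hFneg p.1 p.2 hp.2)]
        exact aux_meas_neg q _ (ih.inter (measurable_fst measurableSet_Iio)) (fun p hp => hp.2)
  -- confinement
  have hconf : ∀ n, ∀ p ∈ S n, |p.1| ≤ 1 := by
    intro n
    induction n with
    | zero =>
      intro p hp
      rw [hS0] at hp
      exact abs_le.2 hp.1.1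
    | succ n ih =>
      intro p hp
      rw [hSsucc] at hp
      obtain ⟨⟨x, y⟩, ⟨h1, h2⟩, rfl⟩ := hp
      have h3 : |x| ≤ 1 := ih _ h1
      have h4 : Real.sqrt |x| ≤ 1 := Real.sqrt_le_one.2 h3
      have h5 := Real.sqrt_nonneg |x|
      rcases lt_or_gt_of_ne h2 with h | h
      · rw [hFneg x y h]
        exact abs_le.2 ⟨by simp only; linarith, by simp only; linarith⟩
      · rw [hFpos x y h]
        rw [abs_of_pos h] at h4 h5
        exact abs_le.2 ⟨by simp only; linarith, by simp only; linarith⟩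
  set c : ℝ := (1 / 2 : ℝ) ^ (2 * q) with hc
  have hc1 : c < 1 := Real.rpow_lt_one (by norm_num) (by norm_num) (by linarith)
  have hslice : ∀ n, ∀ u : ℝ, volume (Prod.mk u ⁻¹' S n) ≤ ENNReal.ofReal c ^ n * 2 := by
    intro n
    induction n with
    | zero =>
      intro u
      have : Prod.mk u ⁻¹' S 0 ⊆ Set.Icc (-1 : ℝ) 1 := by
        intro y hy
        rw [Set.mem_preimage, hS0] at hy
        exact hy.1.2
      refine (measure_mono this).trans ?_
      rw [Real.volume_Icc]
      norm_num
    | succ n ih =>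
      intro u
      by_cases hu : |u| ≤ 1
      swap
      · have : Prod.mk u ⁻¹' S (n + 1) = ∅ := by
          ext y
          simp only [Set.mem_preimage, Set.mem_empty_iff_false, iff_false]
          exact fun h => hu (hconf _ _ h)
        simp [this]
      obtain ⟨hu1, hu2⟩ := abs_le.1 hu
      obtain ⟨s, hs⟩ : ∃ s, s = (1 + u) / 2 := ⟨_, rfl⟩
      have hs0 : 0 ≤ s := by linarith
      have hs1 : 0 ≤ 1 - s := by linarith
      have hsub : Prod.mk u ⁻¹' S (n + 1) ⊆
          ((fun y : ℝ => (y * s ^ (2 * q) + 1) / 2) '' (Prod.mk (s ^ 2) ⁻¹' S n)) ∪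
          ((fun y : ℝ => (y * (1 - s) ^ (2 * q) + (-1)) / 2) ''
            (Prod.mk (-(1 - s) ^ 2) ⁻¹' S n)) := by
        intro y' hy'
        rw [Set.mem_preimage, hSsucc] at hy'
        obtain ⟨⟨x, y⟩, ⟨h1, h2⟩, he⟩ := hy'
        rcases lt_or_gt_of_ne h2 with h | h
        · right
          simp only at h
          rw [hFneg x y h, Prod.mk.injEq] at he
          obtain ⟨e1, e2⟩ := he
          have e3 : Real.sqrt |x| = 1 - s := by linarith
          have e4 : |x| = (1 - s) ^ 2 := by rw [← e3, Real.sq_sqrt (abs_nonneg x)]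
          have e5 : x = -(1 - s) ^ 2 := by rw [← e4, abs_of_neg h]; ring
          refine ⟨y, ?_, ?_⟩
          · rw [Set.mem_preimage, ← e5]; exact h1
          · simp only
            rw [← e2, e4, Real.rpow_mul hs1, Real.rpow_two]; ring
        · left
          simp only at h
          have h : 0 < x := h
          rw [hFpos x y h, Prod.mk.injEq] at he
          obtain ⟨e1, e2⟩ := he
          have e3 : Real.sqrt x = s := by linarith
          have e4 : x = s ^ 2 := by rw [← e3, Real.sq_sqrt h.le]
          refine ⟨y, ?_, ?_⟩
          · rw [Set.mem_preimage, ← e4]; exact h1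
          · simp only
            rw [← e2, e4, Real.rpow_mul hs0, Real.rpow_two]
      have ha := Real.rpow_nonneg hs0 (2 * q)
      have hb := Real.rpow_nonneg hs1 (2 * q)
      have hcv : s ^ (2 * q) / 2 + (1 - s) ^ (2 * q) / 2 ≤ c := by
        have := (Real.concaveOn_rpow (p := 2 * q) (by linarith) (by linarith)).2
          (Set.mem_Ici.2 hs0) (Set.mem_Ici.2 hs1) (by norm_num : (0 : ℝ) ≤ 1 / 2)
          (by norm_num : (0 : ℝ) ≤ 1 / 2) (by norm_num)
        simp only [smul_eq_mul] at this
        rw [show 1 / 2 * s + 1 / 2 * (1 - s) = 1 / 2 by ring] at this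
        linarith
      calc volume (Prod.mk u ⁻¹' S (n + 1)) ≤ _ := measure_mono hsub
        _ ≤ _ := measure_union_le _ _
        _ = _ := by rw [aux_vol _ _ ha, aux_vol _ _ hb]
        _ ≤ ENNReal.ofReal (s ^ (2 * q) / 2) * (ENNReal.ofReal c ^ n * 2) +
            ENNReal.ofReal ((1 - s) ^ (2 * q) / 2) * (ENNReal.ofReal c ^ n * 2) := by
          gcongr
          · exact ih _
          · exact ih _
        _ = ENNReal.ofReal (s ^ (2 * q) / 2 + (1 - s) ^ (2 * q) / 2) *
            (ENNReal.ofReal c ^ n * 2) := by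
          rw [ENNReal.ofReal_add (by positivity) (by positivity), add_mul]
        _ ≤ ENNReal.ofReal c * (ENNReal.ofReal c ^ n * 2) := by gcongr
        _ = ENNReal.ofReal c ^ (n + 1) * 2 := by rw [pow_succ']; ring
  have hlim : Filter.Tendsto (fun n : ℕ => ENNReal.ofReal c ^ n * 2) Filter.atTop (nhds 0) := by
    have h := ENNReal.tendsto_pow_atTop_nhds_zero_of_lt_one (r := ENNReal.ofReal c)
      (by simpa using hc1)
    simpa using ENNReal.Tendsto.mul_const h (Or.inr (by norm_num : (2 : ℝ≥0∞) ≠ ∞))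
  rw [Measure.volume_eq_prod, Measure.measure_prod_null (MeasurableSet.iInter hmeas)]
  refine Filter.Eventually.of_forall fun u => ?_
  refine le_antisymm (ge_of_tendsto' hlim fun n => ?_) zero_le
  exact (measure_mono (Set.preimage_mono (Set.iInter_subset _ n))).trans (hslice n u)
end
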